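/- arXiv:1203.0021 — 5 statements merged into one kernel-verified Lean document; each statement's English description precedes it below -/
import Mathlib

section
/- Let D be a C*-algebra and let E ⊆ D be a multiplicatively closed set of pairwise commuting projections. For e₁, …, eₙ ∈ E write ⋁_{i=1}^n e_i := Σ_{∅≠F⊆{1,…,n}} (−1)^{|F|−1} ∏_{i∈F} e_i (this is the smallest projection in D dominating e₁, …, eₙ). Call E independent if for all e, e₁, …, eₙ ∈ E the equation e = ⋁_{i=1}^n e_i implies e = e_i for some 1 ≤ i ≤ n. Then E is independent if and only if the set {e ∈ E : e ≠ 0} is linearly independent over ℂ. -/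
open Finset in
/-- Inclusion-exclusion for the complement of a product of complements. -/
theorem one_sub_prod_one_sub_eq_sum {K A ι : Type*} [Field K] [CommRing A] [Algebra K A]
    [DecidableEq ι] (s : Finset ι) (f : ι → A) :
    1 - ∏ i ∈ s, (1 - f i) =
      ∑ F ∈ s.powerset.erase ∅, ((-1 : K) ^ (F.card - 1)) • ∏ i ∈ F, f i := by
  have h : ∏ i ∈ s, (1 - f i) = ∑ F ∈ s.powerset, (-1 : A) ^ F.card * ∏ i ∈ F, f i := by
    simp_rw [sub_eq_add_neg, prod_one_add, prod_neg]
  rw [h, ← add_sum_erase _ _ (empty_mem_powerset s)]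
  simp only [card_empty, pow_zero, prod_empty, mul_one, sub_add_cancel_left, ← sum_neg_distrib]
  refine sum_congr rfl fun F hF => ?_
  obtain ⟨k, hk⟩ := Nat.exists_eq_succ_of_ne_zero
    (card_ne_zero.mpr (nonempty_iff_ne_empty.mpr (ne_of_mem_erase hF)))
  simp [hk, pow_succ, Algebra.smul_def]

theorem prod_mem_of_mul_mem {A ι : Type*} [CommMonoid A] {E : Set A}
    (hmul : ∀ e ∈ E, ∀ f ∈ E, e * f ∈ E) {f : ι → A} (hf : ∀ i, f i ∈ E)
    {F : Finset ι} (hF : F.Nonempty) : ∏ i ∈ F, f i ∈ E := by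
  induction hF using Finset.Nonempty.cons_induction with
  | singleton a => simpa using hf a
  | cons a s ha hs ih => simpa using hmul _ (hf a) _ ih

theorem IsIdempotentElem.prod_mul_of_mem {A ι : Type*} [CommMonoid A] {f : ι → A}
    {F : Finset ι} {i : ι} (hi : IsIdempotentElem (f i)) (hF : i ∈ F) :
    (∏ j ∈ F, f j) * f i = ∏ j ∈ F, f j := by
  classical
  rw [← Finset.mul_prod_erase F f hF, mul_right_comm, hi.eq]

theorem one_sub_prod_one_sub_mul_eq {A ι : Type*} [CommRing A] {s : Finset ι} {f : ι → A} {i : ι}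
    (hi : IsIdempotentElem (f i)) (his : i ∈ s) : (1 - ∏ j ∈ s, (1 - f j)) * f i = f i := by
  classical
  rw [← Finset.mul_prod_erase s _ his]
  linear_combination (∏ j ∈ s.erase i, (1 - f j)) * hi.eq

/-- If every element of `s` lies below the idempotent `e` and `e` is orthogonal to the complement
of their join, then `e` is their join. -/
theorem eq_one_sub_prod_one_sub {A ι : Type*} [CommRing A] {s : Finset ι} {f : ι → A} {e : A}
    (hle : ∀ i ∈ s, f i * e = f i) (he : e * ∏ i ∈ s, (1 - f i) = 0) :
    e = 1 - ∏ i ∈ s, (1 - f i) := by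
  suffices h : (1 - e) * ∏ i ∈ s, (1 - f i) = 1 - e by linear_combination h + he
  clear he
  induction s using Finset.cons_induction with
  | empty => simp
  | cons a s ha ih =>
    rw [Finset.forall_mem_cons] at hle
    rw [Finset.prod_cons]
    linear_combination (1 - f a) * ih hle.2 + hle.1

/-- Every nonempty finite set of idempotents has a maximal element. -/
theorem exists_maximal_idempotent {A : Type*} [CommRing A] {T : Finset A} (hT : T.Nonempty)
    (hidem : ∀ e ∈ T, IsIdempotentElem e) : ∃ e ∈ T, ∀ f ∈ T, e * f = e → f = e := by
  classical
  obtain ⟨e, heT, hmax⟩ := T.exists_max_image (fun e => (T.filter fun g => g * e = g).card) hT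
  refine ⟨e, heT, fun f hf hef => ?_⟩
  have hsub : (T.filter fun g => g * e = g) ⊆ T.filter fun g => g * f = g := by
    intro g hg
    simp only [Finset.mem_filter] at hg ⊢
    exact ⟨hg.1, by linear_combination (1 - f) * hg.2 + g * hef⟩
  have heq := Finset.eq_of_subset_of_card_le hsub (hmax f hf)
  have hfe : f ∈ T.filter fun g => g * e = g := by
    rw [heq]
    exact Finset.mem_filter.mpr ⟨hf, (hidem f hf).eq⟩
  rw [← (Finset.mem_filter.mp hfe).2, mul_comm, hef]

/-- A multiplicatively closed set of idempotents is independent for finite joins if its nonzero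
elements are linearly independent. -/
theorem LinearIndepOn.exists_eq_of_eq_join {K A : Type*} [Field K] [CommRing A] [Algebra K A]
    {E : Set A} (hidem : ∀ e ∈ E, IsIdempotentElem e) (hmul : ∀ e ∈ E, ∀ f ∈ E, e * f ∈ E)
    (hli : LinearIndepOn K id {x | x ∈ E ∧ x ≠ 0}) {e : A} (he : e ∈ E)
    {n : ℕ} (hn : 0 < n) {f : Fin n → A} (hf : ∀ i, f i ∈ E) (hef : e = 1 - ∏ i, (1 - f i)) :
    ∃ i, e = f i := by
  have hle (i) : e * f i = f i := by
    rw [hef]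
    exact one_sub_prod_one_sub_mul_eq (hidem _ (hf i)) (Finset.mem_univ i)
  by_contra! hne
  have he0 : e ≠ 0 := fun h => hne ⟨0, hn⟩ (by rw [← hle ⟨0, hn⟩, h, zero_mul])
  refine linearIndepOn_iff_notMem_span.mp hli e ⟨he, he0⟩ ?_
  rw [Set.image_id, id]
  suffices h : 1 - ∏ i, (1 - f i) ∈ Submodule.span K ({x | x ∈ E ∧ x ≠ 0} \ {e}) by
    rwa [← hef] at h
  rw [one_sub_prod_one_sub_eq_sum (K := K)]
  refine sum_mem fun F hF => Submodule.smul_mem _ _ ?_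
  have hFne : F.Nonempty := Finset.nonempty_iff_ne_empty.mpr (Finset.ne_of_mem_erase hF)
  by_cases hF0 : ∏ i ∈ F, f i = 0
  · rw [hF0]
    exact zero_mem _
  refine Submodule.subset_span ⟨⟨prod_mem_of_mul_mem hmul hf hFne, hF0⟩, fun hFe => ?_⟩
  obtain ⟨i, hi⟩ := hFne
  have h := (hidem _ (hf i)).prod_mul_of_mem hi
  rw [Set.mem_singleton_iff.mp hFe, hle] at h
  exact hne i h.symm

/-- The nonzero elements of a multiplicatively closed set of idempotents are linearly independent
if the set is independent for finite joins. -/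
theorem linearIndepOn_of_exists_eq_of_eq_join {K A : Type*} [Field K] [CommRing A] [Algebra K A]
    {E : Set A} (hidem : ∀ e ∈ E, IsIdempotentElem e) (hmul : ∀ e ∈ E, ∀ f ∈ E, e * f ∈ E)
    (hind : ∀ e ∈ E, ∀ n : ℕ, 0 < n → ∀ f : Fin n → A, (∀ i, f i ∈ E) →
      e = 1 - ∏ i, (1 - f i) → ∃ i, e = f i) :
    LinearIndepOn K id {x | x ∈ E ∧ x ≠ 0} := by
  classical
  rw [linearIndepOn_iff']
  intro t g ht hsum
  by_contra! hne
  obtain ⟨a, hat, hga⟩ := hne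
  set T := t.filter fun x => g x ≠ 0 with hT
  have hTE (x) (hx : x ∈ T) : x ∈ E := (ht (Finset.mem_filter.mp hx).1).1
  obtain ⟨e, heT, hmax⟩ := exists_maximal_idempotent (T := T)
    ⟨a, Finset.mem_filter.mpr ⟨hat, hga⟩⟩ fun x hx => hidem x (hTE x hx)
  have he0 : e ≠ 0 := (ht (Finset.mem_filter.mp heT).1).2
  have hsumT : g e • e + ∑ x ∈ T.erase e, g x • x = 0 := by
    rw [Finset.add_sum_erase T (fun x => g x • x) heT, ← hsum, hT]
    refine Finset.sum_filter_of_ne fun x _ hx hgx => hx ?_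
    rw [hgx, zero_smul]
  have hee := (hidem e (hTE e heT)).eq
  have hP : e * ∏ x ∈ T.erase e, (1 - e * x) = 0 := by
    have hx0 : ∀ x ∈ T.erase e, e * x * ∏ y ∈ T.erase e, (1 - e * y) = 0 := by
      intro x hx
      have hex := hidem _ (hmul _ (hTE e heT) _ (hTE x (Finset.mem_of_mem_erase hx)))
      linear_combination -one_sub_prod_one_sub_mul_eq (f := fun y => e * y) hex hx
    have h := congrArg (fun z => z * (e * ∏ x ∈ T.erase e, (1 - e * x))) hsumT
    simp only [add_mul, zero_mul, Finset.sum_mul, smul_mul_assoc] at h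
    rw [Finset.sum_eq_zero, add_zero, ← mul_assoc, hee] at h
    · exact (smul_eq_zero.mp h).resolve_left (Finset.mem_filter.mp heT).2
    · intro x hx
      rw [mul_left_comm, ← mul_assoc, hx0 x hx, smul_zero]
  have hjoin := eq_one_sub_prod_one_sub (s := T.erase e) (f := fun x => e * x)
    (fun x _ => by linear_combination x * hee) hP
  have hcard : 0 < (T.erase e).card := by
    rw [Finset.card_pos, Finset.nonempty_iff_ne_empty]
    intro h
    rw [h, Finset.prod_empty, sub_self] at hjoin
    exact he0 hjoin
  obtain ⟨i, hi⟩ := hind e (hTE e heT) _ hcard (fun i => e * ((T.erase e).equivFin.symm i : A))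
    (fun i => hmul _ (hTE e heT) _ (hTE _ (Finset.mem_of_mem_erase (Subtype.prop _)))) (by
      rw [Equiv.prod_comp (T.erase e).equivFin.symm (fun x => 1 - e * (x : A)),
        Finset.prod_coe_sort (T.erase e) (fun x => 1 - e * x)]
      exact hjoin)
  have hmem := ((T.erase e).equivFin.symm i).prop
  exact Finset.ne_of_mem_erase hmem (hmax _ (Finset.mem_of_mem_erase hmem) hi.symm)

/-- The equivalence of independence for finite joins and linear independence, for a set of
idempotents contained in the image of a commutative algebra. -/
theorem forall_join_iff_linearIndependent_of_subset_range {K A D : Type*} [Field K] [CommRing A]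
    [Algebra K A] [Ring D] [Algebra K D] (φ : A →ₐ[K] D) (hφ : Function.Injective φ) (E : Set D)
    (hrange : ∀ e ∈ E, ∃ a, φ a = e) (hidem : ∀ e ∈ E, IsIdempotentElem e)
    (hcomm : ∀ e ∈ E, ∀ f ∈ E, Commute e f) (hmul : ∀ e ∈ E, ∀ f ∈ E, e * f ∈ E) :
    (∀ e ∈ E, ∀ n : ℕ, 0 < n → ∀ f : Fin n → D, ∀ hf : ∀ i, f i ∈ E,
        e = ∑ F ∈ (Finset.univ : Finset (Fin n)).powerset.erase ∅,
              ((-1 : K) ^ (F.card - 1)) •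
                F.noncommProd f (fun i _ j _ _ => hcomm (f i) (hf i) (f j) (hf j)) →
        ∃ i, e = f i) ↔
      LinearIndependent K (fun e : {x : D // x ∈ E ∧ x ≠ 0} => (e : D)) := by
  have hidem' : ∀ a ∈ φ ⁻¹' E, IsIdempotentElem a := fun a ha =>
    hφ (by rw [map_mul, (hidem _ ha).eq])
  have hmul' : ∀ a ∈ φ ⁻¹' E, ∀ b ∈ φ ⁻¹' E, a * b ∈ φ ⁻¹' E := fun a ha b hb => by
    rw [Set.mem_preimage, map_mul]
    exact hmul _ ha _ hb
  have hjoin {n : ℕ} (f : Fin n → A) (hf : ∀ i, φ (f i) ∈ E) :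
      φ (1 - ∏ i, (1 - f i)) = ∑ F ∈ (Finset.univ : Finset (Fin n)).powerset.erase ∅,
        ((-1 : K) ^ (F.card - 1)) • F.noncommProd (fun i => φ (f i))
          (fun i _ j _ _ => hcomm (φ (f i)) (hf i) (φ (f j)) (hf j)) := by
    rw [one_sub_prod_one_sub_eq_sum (K := K), map_sum]
    refine Finset.sum_congr rfl fun F _ => ?_
    rw [map_smul, ← Finset.noncommProd_eq_prod]
    exact congrArg _ (Finset.map_noncommProd F f _ φ)
  have hli : LinearIndependent K (fun e : {x : D // x ∈ E ∧ x ≠ 0} => (e : D)) ↔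
      LinearIndepOn K id {a | a ∈ φ ⁻¹' E ∧ a ≠ 0} := by
    have himage : φ '' {a | a ∈ φ ⁻¹' E ∧ a ≠ 0} = {x | x ∈ E ∧ x ≠ 0} := by
      ext x
      constructor
      · rintro ⟨a, ⟨haE, ha0⟩, rfl⟩
        exact ⟨haE, (map_ne_zero_iff φ hφ).mpr ha0⟩
      · rintro ⟨hxE, hx0⟩
        obtain ⟨a, rfl⟩ := hrange x hxE
        exact ⟨a, ⟨hxE, (map_ne_zero_iff φ hφ).mp hx0⟩, rfl⟩
    rw [← φ.toLinearMap.linearIndepOn_iff_of_injOn hφ.injOn, Function.comp_id,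
      AlgHom.coe_toLinearMap, linearIndepOn_iff_image hφ.injOn, himage]
    rfl
  rw [hli]
  constructor
  · intro hind
    refine linearIndepOn_of_exists_eq_of_eq_join hidem' hmul' fun e he n hn f hf hef => ?_
    obtain ⟨i, hi⟩ := hind (φ e) he n hn (fun i => φ (f i)) hf (by rw [hef, hjoin f hf])
    exact ⟨i, hφ hi⟩
  · intro hlin e he n hn f hf hef
    obtain ⟨a, rfl⟩ := hrange e he
    choose b hb using fun i => hrange (f i) (hf i)
    obtain rfl : (fun i => φ (b i)) = f := funext hb
    rw [← hjoin b hf] at hef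
    obtain ⟨i, hi⟩ := hlin.exists_eq_of_eq_join hidem' hmul' he hn hf (hφ hef)
    exact ⟨i, congrArg φ hi⟩

open scoped IsMulCommutative in
/-- Let `D` be a C*-algebra and `E ⊆ D` a multiplicatively closed set of pairwise
commuting projections. Writing `⋁ᵢ eᵢ = ∑_{∅≠F⊆{1,…,n}} (−1)^{|F|−1} ∏_{i∈F} eᵢ`, the
set `E` is independent (i.e. `e = ⋁ᵢ eᵢ` with `e, eᵢ ∈ E` forces `e = eᵢ` for some `i`)
if and only if `{e ∈ E : e ≠ 0}` is linearly independent over `ℂ`. -/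
theorem stmt_0 {D : Type*} [NormedRing D] [StarRing D] [CStarRing D]
    [CompleteSpace D] [NormedAlgebra ℂ D] [StarModule ℂ D]
    (E : Set D)
    (hproj : ∀ e ∈ E, IsSelfAdjoint e ∧ IsIdempotentElem e)
    (hcomm : ∀ e ∈ E, ∀ f ∈ E, Commute e f)
    (hmulcl : ∀ e ∈ E, ∀ f ∈ E, e * f ∈ E) :
    (∀ e ∈ E, ∀ n : ℕ, 0 < n → ∀ f : Fin n → D, ∀ hf : ∀ i, f i ∈ E,
        e = ∑ F ∈ (Finset.univ : Finset (Fin n)).powerset.erase ∅,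
              ((-1 : ℂ) ^ (F.card - 1)) •
                F.noncommProd f (fun i _ j _ _ => hcomm (f i) (hf i) (f j) (hf j)) →
        ∃ i, e = f i) ↔
      LinearIndependent ℂ (fun e : {x : D // x ∈ E ∧ x ≠ 0} => (e : D)) := by
  have : IsMulCommutative (Algebra.adjoin ℂ E) := Algebra.isMulCommutative_adjoin ℂ hcomm
  exact forall_join_iff_linearIndependent_of_subset_range (Algebra.adjoin ℂ E).val
    Subtype.val_injective E
    (fun e he => ⟨(⟨e, Algebra.subset_adjoin he⟩ : Algebra.adjoin ℂ E), rfl⟩)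
    (fun e he => (hproj e he).2) hcomm hmulcl
end

section
/- 𝔍 is independent if and only if the set of indicator functions {1_X : X ∈ 𝔍, X ≠ ∅} is linearly independent in the ℂ-vector space of complex-valued functions on 𝔓. -/
/-- A family of subsets (containing `∅` and closed under finite intersections) is
independent if whenever a member equals a finite union of members, it equals one of them. -/
def IsIndepFamily {α : Type*} (J : Set (Set α)) : Prop :=
  ∀ X ∈ J, ∀ n : ℕ, 0 < n → ∀ Xs : Fin n → Set α,
    (∀ i, Xs i ∈ J) → X = ⋃ i, Xs i → ∃ i, X = Xs i

/-- In an independent family, a nonempty member that is the union of a finite set of members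
is one of them. -/
theorem IsIndepFamily.exists_eq_of_eq_biUnion {α ι : Type*} {J : Set (Set α)}
    (hJ : IsIndepFamily J) {X : Set α} (hX : X ∈ J) (hne : X ≠ ∅) (s : Finset ι) (f : ι → Set α)
    (hf : ∀ i ∈ s, f i ∈ J) (h : X = ⋃ i ∈ s, f i) : ∃ i ∈ s, X = f i := by
  have hs : s.Nonempty := by
    rw [Finset.nonempty_iff_ne_empty]
    rintro rfl
    exact hne (by simpa using h)
  obtain ⟨i, hi⟩ := hJ X hX s.card hs.card_pos (fun i => f (s.equivFin.symm i))
    (fun i => hf _ (s.equivFin.symm i).2) (by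
      rw [h, s.equivFin.symm.surjective.iUnion_comp (fun i : s => f i), Set.iUnion_subtype])
  exact ⟨_, (s.equivFin.symm i).2, hi⟩

/-- The linear span of the indicators of an intersection-closed family is closed under
multiplication by such an indicator. -/
theorem mul_indicator_one_mem_span {α R : Type*} [CommRing R] {K : Set (Set α)}
    (hK : ∀ A ∈ K, ∀ B ∈ K, A ∩ B ∈ K) {A : Set α} (hA : A ∈ K) {f : α → R}
    (hf : f ∈ Submodule.span R ((fun B : Set α => B.indicator (fun _ => (1 : R))) '' K)) :
    f * A.indicator (fun _ => (1 : R)) ∈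
      Submodule.span R ((fun B : Set α => B.indicator (fun _ => (1 : R))) '' K) := by
  induction hf using Submodule.span_induction with
  | mem f hf =>
    obtain ⟨B, hB, rfl⟩ := hf
    refine Submodule.subset_span ⟨B ∩ A, hK B hB A hA, ?_⟩
    exact Set.inter_indicator_one
  | zero => simp
  | add f g _ _ hf hg => rw [add_mul]; exact add_mem hf hg
  | smul c f _ hf => rw [smul_mul_assoc]; exact Submodule.smul_mem _ c hf

/-- The indicator of a finite union of members of an intersection-closed family is a linear
combination of indicators of members. -/
theorem indicator_biUnion_mem_span {α ι R : Type*} [CommRing R] {K : Set (Set α)}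
    (hK : ∀ A ∈ K, ∀ B ∈ K, A ∩ B ∈ K) (s : Finset ι) (f : ι → Set α)
    (hf : ∀ i ∈ s, f i ∈ K) :
    (⋃ i ∈ s, f i).indicator (fun _ => (1 : R)) ∈
      Submodule.span R ((fun B : Set α => B.indicator (fun _ => (1 : R))) '' K) := by
  classical
  induction s using Finset.induction_on with
  | empty =>
    simp only [Finset.notMem_empty, Set.iUnion_of_empty, Set.iUnion_empty, Set.indicator_empty]
    exact Submodule.zero_mem _
  | insert a s _ ih =>
    have hs := ih fun i hi => hf i (Finset.mem_insert_of_mem hi)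
    have ha := hf a (Finset.mem_insert_self a s)
    have key : (⋃ i ∈ insert a s, f i).indicator (fun _ => (1 : R)) =
        (f a).indicator (fun _ => (1 : R)) + (⋃ i ∈ s, f i).indicator (fun _ => (1 : R)) -
          (⋃ i ∈ s, f i).indicator (fun _ => (1 : R)) * (f a).indicator (fun _ => (1 : R)) := by
      rw [Finset.set_biUnion_insert]
      ext p
      by_cases h₁ : p ∈ f a <;> by_cases h₂ : p ∈ ⋃ i ∈ s, f i <;>
        simp only [Set.indicator, Pi.add_apply, Pi.sub_apply, Pi.mul_apply, Set.mem_union, h₁, h₂,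
          if_true, if_false, or_true, or_false] <;> simp
    rw [key]
    exact sub_mem (add_mem (Submodule.subset_span ⟨_, ha, rfl⟩) hs)
      (mul_indicator_one_mem_span hK ha hs)

/-- `𝔍` is independent iff the indicator functions of its nonempty members are linearly
independent in the `ℂ`-vector space of complex-valued functions on `𝔓`. -/
theorem stmt_1 {𝔓 : Type*} (J : Set (Set 𝔓)) (h0 : (∅ : Set 𝔓) ∈ J)
    (hcap : ∀ X ∈ J, ∀ Y ∈ J, X ∩ Y ∈ J) :
    IsIndepFamily J ↔
      LinearIndependent ℂ
        (fun X : {X : Set 𝔓 // X ∈ J ∧ X ≠ ∅} =>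
          Set.indicator (X : Set 𝔓) (fun _ => (1 : ℂ)) : _ → 𝔓 → ℂ) := by
  classical
  constructor
  · intro hJ
    rw [linearIndependent_iff]
    intro l hl
    by_contra hne
    obtain ⟨X, hX⟩ := l.support.exists_maximal (Finsupp.support_nonempty_iff.2 hne)
    obtain ⟨p, hpX, hp⟩ : ∃ p ∈ X.1, ∀ Y ∈ l.support.erase X, p ∉ Y.1 := by
      by_contra! hcov
      obtain ⟨Y, hY, hXY⟩ := hJ.exists_eq_of_eq_biUnion X.2.1 X.2.2 (l.support.erase X)
        (fun Y => X.1 ∩ Y.1) (fun Y _ => hcap _ X.2.1 _ Y.2.1) (by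
          ext p
          simp only [Set.mem_iUnion, Set.mem_inter_iff, exists_prop]
          constructor
          · intro hp
            obtain ⟨Y, hY, hpY⟩ := hcov p hp
            exact ⟨Y, hY, hp, hpY⟩
          · rintro ⟨_, _, hp, _⟩
            exact hp)
      have hle : X ≤ Y := Set.left_eq_inter.1 hXY
      exact Finset.ne_of_mem_erase hY (hX.eq_of_le (Finset.mem_of_mem_erase hY) hle).symm
    have hsum := congrFun hl p
    rw [Finsupp.linearCombination_apply, Finsupp.sum, Finset.sum_apply,
      Finset.sum_eq_single_of_mem X hX.prop fun Y hY hYX => by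
        simp [hp Y (Finset.mem_erase.2 ⟨hYX, hY⟩)]] at hsum
    exact Finsupp.mem_support_iff.1 hX.prop (by simpa [hpX] using hsum)
  · intro hli X hX n hn Xs hXs hU
    by_contra! hne
    have hsub : ∀ i, Xs i ⊆ X := fun i => hU ▸ Set.subset_iUnion Xs i
    have hX0 : X ≠ ∅ := by
      rintro rfl
      exact hne ⟨0, hn⟩ (Set.subset_empty_iff.1 (hsub _)).symm
    have hmem := indicator_biUnion_mem_span (R := ℂ) (K := {Y | Y ∈ J ∧ Y ⊂ X})
      (fun A hA B hB => ⟨hcap A hA.1 B hB.1, Set.inter_subset_left.trans_ssubset hA.2⟩)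
      Finset.univ Xs (fun i _ => ⟨hXs i, (hsub i).ssubset_of_ne (hne i).symm⟩)
    simp only [Finset.mem_univ, Set.iUnion_true, ← hU] at hmem
    refine linearIndependent_iff_notMem_span.1 hli ⟨X, hX, hX0⟩
      (Submodule.span_le.2 ?_ hmem)
    rintro _ ⟨Y, ⟨hYJ, hYX⟩, rfl⟩
    by_cases hY : Y = ∅
    · simp only [hY, Set.indicator_empty]
      exact Submodule.zero_mem _
    · refine Submodule.subset_span ⟨⟨Y, hYJ, hY⟩, ⟨trivial, ?_⟩, rfl⟩
      simpa using hYX.ne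
end

section
/- Assume 𝔍 is independent. Let T be a C*-algebra and let (e_X)_{X ∈ 𝔍} be projections (self-adjoint idempotents) in T satisfying e_∅ = 0 and e_{X₁∩X₂} = e_{X₁} e_{X₂} for all X₁, X₂ ∈ 𝔍. Then there exists a unique *-algebra homomorphism D → T sending 1_X to e_X for all X ∈ 𝔍. -/
variable {𝔓 : Type*} [TopologicalSpace 𝔓] [DiscreteTopology 𝔓]

/-- The indicator function `1_X`, as an element of `ℓ^∞(𝔓)` (realized as the C*-algebra
of bounded continuous functions on the discrete space `𝔓`). -/
noncomputable def indFn (X : Set 𝔓) : BoundedContinuousFunction 𝔓 ℂ :=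
  BoundedContinuousFunction.ofNormedAddCommGroup (Set.indicator X fun _ => (1 : ℂ))
    continuous_of_discreteTopology 1
    (by
      intro x
      by_cases hx : x ∈ X <;> simp [Set.indicator, hx])

/-- `D`, the smallest norm-closed `*`-subalgebra of `ℓ^∞(𝔓)` containing
`{1_X : X ∈ 𝔍}`. -/
noncomputable def Dalg (J : Set (Set 𝔓)) :
    NonUnitalStarSubalgebra ℂ (BoundedContinuousFunction 𝔓 ℂ) :=
  (NonUnitalStarAlgebra.adjoin ℂ (indFn '' J)).topologicalClosure

lemma indFn_mem_Dalg {J : Set (Set 𝔓)} {X : Set 𝔓} (hX : X ∈ J) : indFn X ∈ Dalg J :=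
  NonUnitalStarSubalgebra.le_topologicalClosure _
    (NonUnitalStarAlgebra.subset_adjoin ℂ _ ⟨X, hX, rfl⟩)

/-- `1_X` as an element of `D`, for `X ∈ 𝔍`. -/
noncomputable def indEl (J : Set (Set 𝔓)) (X : Set 𝔓) (hX : X ∈ J) : Dalg J :=
  ⟨indFn X, indFn_mem_Dalg hX⟩

section GraphHom

variable {A T : Type*} [NonUnitalCStarAlgebra A] [NonUnitalCStarAlgebra T]

/-- A `*`-subalgebra of `A × T` on which the second coordinate is dominated by the first is the
graph of a `*`-homomorphism on every `*`-subalgebra over which it lies surjectively. -/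
lemma exists_starHom_of_graph (E : NonUnitalStarSubalgebra ℂ (A × T))
    (hE : ∀ z ∈ E, ‖z.2‖ ≤ ‖z.1‖) (D : NonUnitalStarSubalgebra ℂ A)
    (hD : ∀ d ∈ D, ∃ t, (d, t) ∈ E) :
    ∃ φ : D →⋆ₙₐ[ℂ] T, ∀ (d : D) (t : T), ((d : A), t) ∈ E → φ d = t := by
  have huniq : ∀ a t t', (a, t) ∈ E → (a, t') ∈ E → t = t' := fun a t t' h h' ↦ by
    have := hE _ (sub_mem h h')
    simpa [sub_eq_zero] using this
  choose f hf using fun d : D ↦ hD d d.2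
  refine ⟨{ toFun := f, map_smul' := ?_, map_zero' := ?_, map_add' := ?_, map_mul' := ?_,
            map_star' := ?_ }, fun d t h ↦ huniq _ _ _ (hf d) h⟩
  · exact fun c x ↦ huniq _ _ _ (hf _) (SMulMemClass.smul_mem c (hf x))
  · exact huniq _ _ _ (hf _) (zero_mem E)
  · exact fun x y ↦ huniq _ _ _ (hf _) (add_mem (hf x) (hf y))
  · exact fun x y ↦ huniq _ _ _ (hf _) (mul_mem (hf x) (hf y))
  · exact fun x ↦ huniq _ _ _ (hf _) (star_mem (hf x))

/-- If the second coordinate is dominated by the first on a closed `*`-subalgebra of `A × T`,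
then the projection of this subalgebra to `A` is closed. -/
lemma isClosed_fst_image_of_norm_le (E : NonUnitalStarSubalgebra ℂ (A × T))
    (hcl : IsClosed (E : Set (A × T))) (hE : ∀ z ∈ E, ‖z.2‖ ≤ ‖z.1‖) :
    IsClosed (Prod.fst '' (E : Set (A × T))) := by
  have hiso : Isometry (fun z : E ↦ (z : A × T).1) := Isometry.of_dist_eq fun x y ↦ by
    have h := hE _ (sub_mem x.2 y.2)
    rw [Subtype.dist_eq, dist_eq_norm, dist_eq_norm, Prod.norm_def, Prod.fst_sub]
    exact (max_eq_left h).symm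
  have : CompleteSpace E := hcl.completeSpace_coe
  have h := hiso.isClosedEmbedding.isClosed_range
  rwa [show Set.range (fun z : E ↦ (z : A × T).1) = Prod.fst '' (E : Set (A × T)) by
    ext; simp] at h

end GraphHom

open Unitization WeakDual in
/-- In a commutative C*-algebra the norm is detected by the multiplicative functionals. -/
lemma norm_le_of_forall_starHom_norm_le {A : Type*} [NonUnitalCommCStarAlgebra A] {a : A} {r : ℝ}
    (hr : 0 ≤ r) (h : ∀ χ : A →⋆ₙₐ[ℂ] ℂ, ‖χ a‖ ≤ r) : ‖a‖ ≤ r := by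
  have hiso := gelfandTransform_isometry (Unitization ℂ A)
  have hnorm : ‖gelfandTransform ℂ (Unitization ℂ A) (a : Unitization ℂ A)‖ = ‖a‖ := by
    rw [hiso.norm_map_of_map_zero (map_zero _), norm_inr]
  rw [← hnorm, ContinuousMap.norm_le _ hr]
  intro χ
  exact h ((NonUnitalStarAlgHomClass.toNonUnitalStarAlgHom χ).comp (inrNonUnitalStarAlgHom ℂ A))

/-- Evaluation at a point, as a `*`-homomorphism on `ℓ^∞(𝔓)`. -/
noncomputable def evalStarHom (p : 𝔓) : BoundedContinuousFunction 𝔓 ℂ →⋆ₙₐ[ℂ] ℂ where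
  toFun f := f p
  map_smul' _ _ := rfl
  map_zero' := rfl
  map_add' _ _ := rfl
  map_mul' _ _ := rfl
  map_star' _ := rfl

lemma indFn_apply_of_mem {X : Set 𝔓} {p : 𝔓} (h : p ∈ X) : indFn X p = 1 :=
  Set.indicator_of_mem h fun _ ↦ (1 : ℂ)

lemma indFn_apply_of_notMem {X : Set 𝔓} {p : 𝔓} (h : p ∉ X) : indFn X p = 0 :=
  Set.indicator_of_notMem h fun _ ↦ (1 : ℂ)

/-- In an independent family, a nonempty member is not covered by finitely many members none of
which contains it. -/
lemma IsIndepFamily.exists_mem_forall_notMem {α : Type*} {J : Set (Set α)} (hind : IsIndepFamily J)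
    (h0 : ∅ ∈ J) (hcap : ∀ X ∈ J, ∀ Y ∈ J, X ∩ Y ∈ J) {Y : Set α} (hY : Y ∈ J) (hne : Y ≠ ∅)
    (F : Finset (Set α)) (hF : ∀ X ∈ F, X ∈ J ∧ ¬ Y ⊆ X) : ∃ p ∈ Y, ∀ X ∈ F, p ∉ X := by
  classical
  by_contra! hcon
  have hmem : ∀ X ∈ insert ∅ F, X ∈ J ∧ ¬ Y ⊆ X := by
    simp only [Finset.mem_insert, forall_eq_or_imp]
    exact ⟨⟨h0, fun h ↦ hne (Set.subset_empty_iff.1 h)⟩, hF⟩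
  let G := (insert ∅ F).equivFin.symm
  obtain ⟨i, hi⟩ := hind Y hY _ (Finset.card_pos.2 (Finset.insert_nonempty ∅ F))
    (fun i ↦ Y ∩ (G i : Set α)) (fun i ↦ hcap _ hY _ (hmem _ (G i).2).1) <| by
      rw [← Set.inter_iUnion, eq_comm, Set.inter_eq_left]
      intro p hp
      obtain ⟨X, hX, hpX⟩ := hcon p hp
      exact Set.mem_iUnion.2 ⟨G.symm ⟨X, Finset.mem_insert_of_mem hX⟩, by simpa using hpX⟩
  exact (hmem _ (G i).2).2 (Set.inter_eq_left.1 hi.symm)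

section Multiplicative

variable {J : Set (Set 𝔓)} {T : Type*}

/-- On finitely many members of an independent family, a character of the projections `e X` is
given by evaluation at a point, or vanishes. -/
lemma exists_starHom_eq_on_finset [NonUnitalCStarAlgebra T] (h0 : (∅ : Set 𝔓) ∈ J)
    (hcap : ∀ X ∈ J, ∀ Y ∈ J, X ∩ Y ∈ J) (hind : IsIndepFamily J) (e : Set 𝔓 → T)
    (heidem : ∀ X ∈ J, IsIdempotentElem (e X)) (he0 : e ∅ = 0)
    (hemul : ∀ X ∈ J, ∀ Y ∈ J, e (X ∩ Y) = e X * e Y) (χ : T →⋆ₙₐ[ℂ] ℂ)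
    (F : Finset (Set 𝔓)) (hF : ∀ X ∈ F, X ∈ J) :
    ∃ ψ : BoundedContinuousFunction 𝔓 ℂ →⋆ₙₐ[ℂ] ℂ, (∀ f, ‖ψ f‖ ≤ ‖f‖) ∧
      ∀ X ∈ F, χ (e X) = ψ (indFn X) := by
  classical
  have h01 : ∀ X ∈ J, χ (e X) = 0 ∨ χ (e X) = 1 := fun X hX ↦
    IsIdempotentElem.iff_eq_zero_or_one.1 ((heidem X hX).map χ)
  have hinter : ∀ G : Finset (Set 𝔓), G.Nonempty → (∀ X ∈ G, X ∈ J ∧ χ (e X) = 1) →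
      ∃ Y ∈ J, χ (e Y) = 1 ∧ ∀ X ∈ G, Y ⊆ X := by
    intro G hG
    induction hG using Finset.Nonempty.cons_induction with
    | singleton X =>
      intro h
      have := h X (by simp)
      exact ⟨X, this.1, this.2, by simp⟩
    | cons X G hX hG ih =>
      intro h
      obtain ⟨Y, hY, hχ, hsub⟩ := ih fun Z hZ ↦ h Z (Finset.mem_cons_of_mem hZ)
      obtain ⟨hXJ, hXχ⟩ := h X (Finset.mem_cons_self X G)
      refine ⟨X ∩ Y, hcap _ hXJ _ hY, by simp [hemul _ hXJ _ hY, hXχ, hχ], ?_⟩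
      simp only [Finset.mem_cons, forall_eq_or_imp]
      exact ⟨Set.inter_subset_left, fun Z hZ ↦ Set.inter_subset_right.trans (hsub Z hZ)⟩
  by_cases hne : (F.filter fun X ↦ χ (e X) = 1).Nonempty
  · obtain ⟨Y, hY, hχ, hsub⟩ := hinter _ hne fun X hX ↦
      ⟨hF X (Finset.mem_filter.1 hX).1, (Finset.mem_filter.1 hX).2⟩
    obtain ⟨p, hpY, hp⟩ := hind.exists_mem_forall_notMem h0 hcap hY
      (by rintro rfl; simp [he0] at hχ) (F.filter fun X ↦ χ (e X) = 0) <| by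
        intro X hX
        obtain ⟨hXF, hX0⟩ := Finset.mem_filter.1 hX
        refine ⟨hF X hXF, fun hYX ↦ ?_⟩
        have := hemul Y hY X (hF X hXF)
        rw [Set.inter_eq_left.2 hYX] at this
        rw [this, map_mul, hX0, mul_zero] at hχ
        exact zero_ne_one hχ
    refine ⟨evalStarHom p, fun f ↦ f.norm_coe_le_norm p, fun X hX ↦ ?_⟩
    change _ = indFn X p
    obtain h | h := h01 X (hF X hX)
    · rw [h, indFn_apply_of_notMem (hp X (Finset.mem_filter.2 ⟨hX, h⟩))]
    · rw [h, indFn_apply_of_mem (hsub X (Finset.mem_filter.2 ⟨hX, h⟩) hpY)]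
  · refine ⟨0, fun f ↦ by simp, fun X hX ↦ ?_⟩
    obtain h | h := h01 X (hF X hX)
    · simpa using h
    · exact (hne ⟨X, Finset.mem_filter.2 ⟨hX, h⟩⟩).elim

/-- A relation between characters on elements of the `*`-algebra generated by the pairs
`(1_X, e_X)` depends on finitely many generators only. -/
lemma exists_finset_of_mem_adjoin [NonUnitalCStarAlgebra T] (e : Set 𝔓 → T)
    {z : BoundedContinuousFunction 𝔓 ℂ × T}
    (hz : z ∈ NonUnitalStarAlgebra.adjoin ℂ ((fun X ↦ (indFn X, e X)) '' J)) :
    ∃ F : Finset (Set 𝔓), (∀ X ∈ F, X ∈ J) ∧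
      ∀ (χ : T →⋆ₙₐ[ℂ] ℂ) (ψ : BoundedContinuousFunction 𝔓 ℂ →⋆ₙₐ[ℂ] ℂ),
        (∀ X ∈ F, χ (e X) = ψ (indFn X)) → χ z.2 = ψ z.1 := by
  classical
  induction hz using NonUnitalStarAlgebra.adjoin_induction with
  | mem x hx =>
    obtain ⟨X, hX, rfl⟩ := hx
    exact ⟨{X}, by simpa using hX, fun χ ψ h ↦ h X (by simp)⟩
  | zero => exact ⟨∅, by simp, by simp⟩
  | add x y _ _ hx hy =>
    obtain ⟨F, hF, hFx⟩ := hx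
    obtain ⟨G, hG, hGy⟩ := hy
    refine ⟨F ∪ G, fun X hX ↦ (Finset.mem_union.1 hX).elim (hF X) (hG X), fun χ ψ h ↦ ?_⟩
    simp [hFx χ ψ fun X hX ↦ h X (Finset.mem_union_left G hX),
      hGy χ ψ fun X hX ↦ h X (Finset.mem_union_right F hX)]
  | mul x y _ _ hx hy =>
    obtain ⟨F, hF, hFx⟩ := hx
    obtain ⟨G, hG, hGy⟩ := hy
    refine ⟨F ∪ G, fun X hX ↦ (Finset.mem_union.1 hX).elim (hF X) (hG X), fun χ ψ h ↦ ?_⟩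
    simp [hFx χ ψ fun X hX ↦ h X (Finset.mem_union_left G hX),
      hGy χ ψ fun X hX ↦ h X (Finset.mem_union_right F hX)]
  | smul r x _ hx =>
    obtain ⟨F, hF, hFx⟩ := hx
    exact ⟨F, hF, fun χ ψ h ↦ by simp [hFx χ ψ h]⟩
  | star x _ hx =>
    obtain ⟨F, hF, hFx⟩ := hx
    exact ⟨F, hF, fun χ ψ h ↦ by simp [map_star, hFx χ ψ h]⟩

/-- Existence of the homomorphism `1_X ↦ e_X` into a commutative C*-algebra. -/
lemma exists_starHom_of_comm [NonUnitalCommCStarAlgebra T] (h0 : (∅ : Set 𝔓) ∈ J)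
    (hcap : ∀ X ∈ J, ∀ Y ∈ J, X ∩ Y ∈ J) (hind : IsIndepFamily J) (e : Set 𝔓 → T)
    (heidem : ∀ X ∈ J, IsIdempotentElem (e X)) (he0 : e ∅ = 0)
    (hemul : ∀ X ∈ J, ∀ Y ∈ J, e (X ∩ Y) = e X * e Y) :
    ∃ φ : Dalg J →⋆ₙₐ[ℂ] T, ∀ X : Set 𝔓, ∀ hX : X ∈ J, φ (indEl J X hX) = e X := by
  let E₀ := NonUnitalStarAlgebra.adjoin ℂ ((fun X ↦ (indFn X, e X)) '' J)
  let E := E₀.topologicalClosure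
  have hE₀ : ∀ z ∈ E₀, ‖z.2‖ ≤ ‖z.1‖ := by
    intro z hz
    obtain ⟨F, hF, hFz⟩ := exists_finset_of_mem_adjoin e hz
    refine norm_le_of_forall_starHom_norm_le (norm_nonneg _) fun χ ↦ ?_
    obtain ⟨ψ, hψ, hχψ⟩ :=
      exists_starHom_eq_on_finset h0 hcap hind e heidem he0 hemul χ F hF
    exact hFz χ ψ hχψ ▸ hψ z.1
  have hE : ∀ z ∈ E, ‖z.2‖ ≤ ‖z.1‖ := fun z hz ↦
    closure_minimal (t := {z : BoundedContinuousFunction 𝔓 ℂ × T | ‖z.2‖ ≤ ‖z.1‖}) hE₀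
      (isClosed_le (by fun_prop) (by fun_prop)) hz
  have hgen : ∀ X ∈ J, (indFn X, e X) ∈ E := fun X hX ↦
    E₀.le_topologicalClosure (NonUnitalStarAlgebra.subset_adjoin ℂ _ ⟨X, hX, rfl⟩)
  have hcl := isClosed_fst_image_of_norm_le E E₀.isClosed_topologicalClosure hE
  have hD : Dalg J ≤ E.map (NonUnitalStarAlgHom.fst ℂ _ _) := by
    refine NonUnitalStarSubalgebra.topologicalClosure_minimal _
      (NonUnitalStarAlgebra.adjoin_le ?_) hcl
    rintro _ ⟨X, hX, rfl⟩
    exact ⟨_, hgen X hX, rfl⟩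
  obtain ⟨φ, hφ⟩ := exists_starHom_of_graph E hE (Dalg J) fun d hd ↦ by
    obtain ⟨z, hz, rfl⟩ := hD hd
    exact ⟨z.2, hz⟩
  exact ⟨φ, fun X hX ↦ hφ _ _ (hgen X hX)⟩

open scoped IsMulCommutative in
/-- Existence of the homomorphism `1_X ↦ e_X` into an arbitrary C*-algebra. -/
lemma exists_starHom_of_projections [NonUnitalCStarAlgebra T] (h0 : (∅ : Set 𝔓) ∈ J)
    (hcap : ∀ X ∈ J, ∀ Y ∈ J, X ∩ Y ∈ J) (hind : IsIndepFamily J) (e : Set 𝔓 → T)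
    (heproj : ∀ X ∈ J, IsSelfAdjoint (e X) ∧ IsIdempotentElem (e X)) (he0 : e ∅ = 0)
    (hemul : ∀ X ∈ J, ∀ Y ∈ J, e (X ∩ Y) = e X * e Y) :
    ∃ φ : Dalg J →⋆ₙₐ[ℂ] T, ∀ X : Set 𝔓, ∀ hX : X ∈ J, φ (indEl J X hX) = e X := by
  classical
  have hcomm : ∀ a ∈ e '' J, ∀ b ∈ e '' J, a * b = b * a := by
    rintro _ ⟨X, hX, rfl⟩ _ ⟨Y, hY, rfl⟩
    rw [← hemul X hX Y hY, ← hemul Y hY X hX, Set.inter_comm]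
  have hstar : ∀ b ∈ e '' J, star b = b := by
    rintro _ ⟨X, hX, rfl⟩
    exact (heproj X hX).1
  let S₀ := NonUnitalStarAlgebra.adjoin ℂ (e '' J)
  let S := S₀.topologicalClosure
  have hS : IsClosed (S : Set T) := S₀.isClosed_topologicalClosure
  have : IsMulCommutative S₀ := NonUnitalStarAlgebra.isMulCommutative_adjoin ℂ hcomm
    fun a ha b hb ↦ by rw [hstar b hb, hcomm a ha b hb]
  let _ : NonUnitalCommRing S := S₀.nonUnitalCommRingTopologicalClosure mul_comm
  let _ : NonUnitalCommCStarAlgebra S := { }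
  have hmem : ∀ X ∈ J, e X ∈ S := fun X hX ↦
    S₀.le_topologicalClosure (NonUnitalStarAlgebra.subset_adjoin ℂ _ ⟨X, hX, rfl⟩)
  let e' : Set 𝔓 → S := fun X ↦ if hX : X ∈ J then ⟨e X, hmem X hX⟩ else 0
  have he' : ∀ X ∈ J, (e' X : T) = e X := fun X hX ↦ by simp [e', hX]
  obtain ⟨φ, hφ⟩ := exists_starHom_of_comm h0 hcap hind e'
    (fun X hX ↦ Subtype.ext <| by
      change (e' X : T) * (e' X : T) = e' X
      rw [he' X hX]
      exact (heproj X hX).2)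
    (Subtype.ext <| by rw [he' _ h0, he0]; rfl)
    (fun X hX Y hY ↦ Subtype.ext <| by
      change (e' (X ∩ Y) : T) = (e' X : T) * (e' Y : T)
      rw [he' X hX, he' Y hY, he' _ (hcap X hX Y hY), hemul X hX Y hY])
  refine ⟨(NonUnitalStarSubalgebraClass.subtype S).comp φ, fun X hX ↦ ?_⟩
  change ((φ (indEl J X hX) : S) : T) = e X
  rw [hφ X hX, he' X hX]

/-- `*`-homomorphisms on `D` are determined by their values on the indicator functions. -/
lemma starHom_ext_indEl [NonUnitalCStarAlgebra T] {φ ψ : Dalg J →⋆ₙₐ[ℂ] T}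
    (h : ∀ X : Set 𝔓, ∀ hX : X ∈ J, φ (indEl J X hX) = ψ (indEl J X hX)) : φ = ψ := by
  have hcl : IsClosed (Dalg J : Set (BoundedContinuousFunction 𝔓 ℂ)) :=
    NonUnitalStarSubalgebra.isClosed_topologicalClosure _
  let _ : NonUnitalCStarAlgebra (Dalg J) := NonUnitalStarSubalgebra.nonUnitalCStarAlgebra (Dalg J)
  have hcont (χ : Dalg J →⋆ₙₐ[ℂ] T) : Continuous χ :=
    AddMonoidHomClass.continuous_of_bound χ 1 fun x ↦ by
      simpa using NonUnitalStarAlgHom.norm_apply_le χ x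
  have hle := NonUnitalStarSubalgebra.le_topologicalClosure
    (NonUnitalStarAlgebra.adjoin ℂ (indFn '' J))
  have hadj : ∀ d (hd : d ∈ NonUnitalStarAlgebra.adjoin ℂ (indFn '' J)),
      φ ⟨d, hle hd⟩ = ψ ⟨d, hle hd⟩ := by
    intro d hd
    induction hd using NonUnitalStarAlgebra.adjoin_induction with
    | mem x hx =>
      obtain ⟨X, hX, rfl⟩ := hx
      exact h X hX
    | zero => exact (map_zero φ).trans (map_zero ψ).symm
    | add x y hx hy ihx ihy =>
      have h (χ : Dalg J →⋆ₙₐ[ℂ] T) := map_add χ ⟨x, hle hx⟩ ⟨y, hle hy⟩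
      exact (h φ).trans ((congrArg₂ _ ihx ihy).trans (h ψ).symm)
    | mul x y hx hy ihx ihy =>
      have h (χ : Dalg J →⋆ₙₐ[ℂ] T) := map_mul χ ⟨x, hle hx⟩ ⟨y, hle hy⟩
      exact (h φ).trans ((congrArg₂ _ ihx ihy).trans (h ψ).symm)
    | smul r x hx ih =>
      have h (χ : Dalg J →⋆ₙₐ[ℂ] T) := map_smul χ r ⟨x, hle hx⟩
      exact (h φ).trans ((congrArg _ ih).trans (h ψ).symm)
    | star x hx ih =>
      have h (χ : Dalg J →⋆ₙₐ[ℂ] T) := map_star χ ⟨x, hle hx⟩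
      exact (h φ).trans ((congrArg _ ih).trans (h ψ).symm)
  ext ⟨d, hd⟩
  have hdense : Dense {x : Dalg J | (x : BoundedContinuousFunction 𝔓 ℂ) ∈
      NonUnitalStarAlgebra.adjoin ℂ (indFn '' J)} := by
    rw [Subtype.dense_iff]
    intro x hx
    refine closure_mono ?_ hx
    exact fun y hy ↦ ⟨⟨y, hle hy⟩, hy, rfl⟩
  exact congrFun ((hcont φ).ext_on hdense (hcont ψ) fun x hx ↦ hadj x hx) ⟨d, hd⟩

end Multiplicative

/-- If `𝔍` is independent, projections `e_X` in a C*-algebra `T` with `e_∅ = 0` and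
`e_{X₁∩X₂} = e_{X₁}e_{X₂}` induce a unique `*`-homomorphism `D → T`, `1_X ↦ e_X`. -/
theorem stmt_2 {J : Set (Set 𝔓)} (h0 : (∅ : Set 𝔓) ∈ J)
    (hcap : ∀ X ∈ J, ∀ Y ∈ J, X ∩ Y ∈ J) (hind : IsIndepFamily J)
    {T : Type*} [NonUnitalNormedRing T] [StarRing T] [CStarRing T] [CompleteSpace T]
    [NormedSpace ℂ T] [IsScalarTower ℂ T T] [SMulCommClass ℂ T T] [StarModule ℂ T]
    (e : Set 𝔓 → T)
    (heproj : ∀ X ∈ J, IsSelfAdjoint (e X) ∧ IsIdempotentElem (e X))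
    (he0 : e ∅ = 0)
    (hemul : ∀ X ∈ J, ∀ Y ∈ J, e (X ∩ Y) = e X * e Y) :
    ∃! φ : Dalg J →⋆ₙₐ[ℂ] T, ∀ X : Set 𝔓, ∀ hX : X ∈ J, φ (indEl J X hX) = e X := by
  let _ : NonUnitalCStarAlgebra T := { }
  obtain ⟨φ, hφ⟩ := exists_starHom_of_projections h0 hcap hind e heproj he0 hemul
  exact ⟨φ, hφ, fun ψ hψ ↦ starHom_ext_indEl fun X hX ↦ (hψ X hX).trans (hφ X hX).symm⟩
end

section
/- Assume 𝔍 is independent. For every function φ: 𝔍 → {0,1} with φ(∅) = 0 and φ(X₁ ∩ X₂) = φ(X₁)φ(X₂) for all X₁, X₂ ∈ 𝔍, there exists a unique algebra homomorphism χ: D → ℂ with χ(1_X) = φ(X) for all X ∈ 𝔍. -/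
variable {𝔓 : Type*} [TopologicalSpace 𝔓] [DiscreteTopology 𝔓]

/-- An algebra homomorphism from a non-unital Banach algebra to the scalars is contractive up
to the factor `‖1‖` of the `L¹`-unitization, hence continuous. -/
lemma NonUnitalAlgHom.continuous_of_completeSpace {A : Type*} [NonUnitalNormedRing A]
    [NormedSpace ℂ A] [IsScalarTower ℂ A A] [SMulCommClass ℂ A A] [CompleteSpace A]
    (χ : A →ₙₐ[ℂ] ℂ) : Continuous χ := by
  let ψ : WithLp 1 (Unitization ℂ A) →ₐ[ℂ] ℂ :=
    (Unitization.lift χ).comp (WithLp.unitizationAlgEquiv (𝕜 := ℂ) (A := A) ℂ).toAlgHom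
  refine AddMonoidHomClass.continuous_of_bound χ ‖(1 : WithLp 1 (Unitization ℂ A))‖ fun a ↦ ?_
  have h := AlgHom.norm_apply_le_self_mul_norm_one ψ (WithLp.toLp 1 (a : Unitization ℂ A))
  have hψ : ψ (WithLp.toLp 1 (a : Unitization ℂ A)) = χ a := by
    simp [ψ]
  rwa [hψ, WithLp.unitization_norm_inr, mul_comm] at h

/-- Evaluation of bounded continuous functions along an ultrafilter. -/
lemma BoundedContinuousFunction.exists_nonUnitalAlgHom_tendsto {α : Type*} [TopologicalSpace α]
    (U : Ultrafilter α) :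
    ∃ χ : BoundedContinuousFunction α ℂ →ₙₐ[ℂ] ℂ, ∀ f : BoundedContinuousFunction α ℂ, Filter.Tendsto f U (nhds (χ f)) := by
  have hlim (f : BoundedContinuousFunction α ℂ) : ∃ z, Filter.Tendsto f U (nhds z) := by
    obtain ⟨z, -, hz⟩ := (isCompact_closedBall (0 : ℂ) ‖f‖).ultrafilter_le_nhds (U.map f)
      (Filter.le_principal_iff.2 (Filter.mem_map.2 (Filter.univ_mem' fun p ↦ by
        simpa using f.norm_coe_le_norm p)))
    exact ⟨z, hz⟩
  choose χ hχ using hlim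
  refine ⟨{ toFun := χ, map_smul' := fun c f ↦ ?_, map_zero' := ?_, map_add' := fun f g ↦ ?_,
            map_mul' := fun f g ↦ ?_ }, hχ⟩
  · exact tendsto_nhds_unique (hχ (c • f)) ((hχ f).const_smul c)
  · exact tendsto_nhds_unique (hχ 0) tendsto_const_nhds
  · exact tendsto_nhds_unique (hχ (f + g)) ((hχ f).add (hχ g))
  · exact tendsto_nhds_unique (hχ (f * g)) ((hχ f).mul (hχ g))

lemma star_indFn (X : Set 𝔓) : star (indFn X) = indFn X := by
  ext p
  by_cases hp : p ∈ X <;> simp [indFn, hp]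

/-- Algebra homomorphisms on `D` are determined by their values on the indicator functions. -/
lemma Dalg.nonUnitalAlgHom_ext {J : Set (Set 𝔓)} {χ ψ : Dalg J →ₙₐ[ℂ] ℂ}
    (h : ∀ X : Set 𝔓, ∀ hX : X ∈ J, χ (indEl J X hX) = ψ (indEl J X hX)) : χ = ψ := by
  have hclosed : IsClosed (Dalg J : Set (BoundedContinuousFunction 𝔓 ℂ)) :=
    NonUnitalStarSubalgebra.isClosed_topologicalClosure _
  have : CompleteSpace (Dalg J) := hclosed.completeSpace_coe
  have hadj : ∀ f (hf : f ∈ NonUnitalStarAlgebra.adjoin ℂ (indFn '' J)),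
      ∀ hf' : f ∈ Dalg J, χ ⟨f, hf'⟩ = ψ ⟨f, hf'⟩ ∧
        χ (star ⟨f, hf'⟩) = ψ (star ⟨f, hf'⟩) := by
    intro f hf
    have hle := NonUnitalStarSubalgebra.le_topologicalClosure
      (NonUnitalStarAlgebra.adjoin ℂ (indFn '' J))
    induction hf using NonUnitalStarAlgebra.adjoin_induction with
    | mem f hf =>
      intro hf'
      obtain ⟨X, hX, rfl⟩ := hf
      have hstar : star (⟨indFn X, hf'⟩ : Dalg J) = ⟨indFn X, hf'⟩ := Subtype.ext (star_indFn X)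
      rw [hstar]
      exact ⟨h X hX, h X hX⟩
    | add f g hf hg ihf ihg =>
      intro hf'
      obtain ⟨h1, h2⟩ := ihf (hle hf)
      obtain ⟨h3, h4⟩ := ihg (hle hg)
      have e : (⟨f + g, hf'⟩ : Dalg J) = ⟨f, hle hf⟩ + ⟨g, hle hg⟩ := rfl
      rw [e, star_add]
      simp only [map_add, h1, h2, h3, h4, and_self]
    | zero =>
      intro hf'
      have e : (⟨0, hf'⟩ : Dalg J) = 0 := rfl
      simp [e]
    | mul f g hf hg ihf ihg =>
      intro hf'
      obtain ⟨h1, h2⟩ := ihf (hle hf)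
      obtain ⟨h3, h4⟩ := ihg (hle hg)
      have e : (⟨f * g, hf'⟩ : Dalg J) = ⟨f, hle hf⟩ * ⟨g, hle hg⟩ := rfl
      rw [e, star_mul]
      simp only [map_mul, h1, h2, h3, h4, and_self]
    | smul r f hf ihf =>
      intro hf'
      obtain ⟨h1, h2⟩ := ihf (hle hf)
      have e : (⟨r • f, hf'⟩ : Dalg J) = r • ⟨f, hle hf⟩ := rfl
      rw [e, star_smul]
      simp only [map_smul, h1, h2, and_self]
    | star f hf ihf =>
      intro hf'
      obtain ⟨h1, h2⟩ := ihf (hle hf)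
      have e : (⟨star f, hf'⟩ : Dalg J) = star ⟨f, hle hf⟩ := rfl
      rw [e, star_star]
      exact ⟨h2, h1⟩
  have hdense : Dense {x : Dalg J | (x : BoundedContinuousFunction 𝔓 ℂ) ∈
      NonUnitalStarAlgebra.adjoin ℂ (indFn '' J)} := by
    rw [Subtype.dense_iff]
    refine fun f hf ↦ closure_mono (fun g hg ↦ ?_) hf
    exact ⟨⟨g, NonUnitalStarSubalgebra.le_topologicalClosure _ hg⟩, hg, rfl⟩
  exact DFunLike.coe_injective <| Continuous.ext_on hdense χ.continuous_of_completeSpace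
    ψ.continuous_of_completeSpace fun x hx ↦ (hadj x hx x.2).1

/-- If `𝔍` is independent and `φ` does not vanish identically, then on any finite subfamily
containing a set with value `1`, `φ` is given by membership of some point. -/
lemma IsIndepFamily.exists_indFn_eq {J : Set (Set 𝔓)}
    (hcap : ∀ X ∈ J, ∀ Y ∈ J, X ∩ Y ∈ J) (hind : IsIndepFamily J)
    {φ : Set 𝔓 → ℂ} (hval : ∀ X ∈ J, φ X = 0 ∨ φ X = 1) (h0 : φ ∅ = 0)
    (hmul : ∀ X ∈ J, ∀ Y ∈ J, φ (X ∩ Y) = φ X * φ Y) {X₀ : Set 𝔓} (hX₀ : X₀ ∈ J)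
    (hφ : φ X₀ = 1) (F : Finset (Set 𝔓)) (hF : (F : Set (Set 𝔓)) ⊆ J) :
    ∃ p, ∀ X ∈ F, indFn X p = φ X := by
  classical
  obtain ⟨Y, hY, hφY, hYF⟩ : ∃ Y ∈ J, φ Y = 1 ∧ ∀ X ∈ F, φ X = 1 → Y ⊆ X := by
    induction F using Finset.induction_on with
    | empty => exact ⟨X₀, hX₀, hφ, by simp⟩
    | insert Z F hZ ih =>
      rw [Finset.coe_insert, Set.insert_subset_iff] at hF
      obtain ⟨Y, hY, hφY, hYF⟩ := ih hF.2
      rcases hval Z hF.1 with hZ0 | hZ1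
      · refine ⟨Y, hY, hφY, fun X hX hX1 ↦ ?_⟩
        rcases Finset.mem_insert.1 hX with rfl | hX
        · simp [hZ0] at hX1
        · exact hYF X hX hX1
      · refine ⟨Z ∩ Y, hcap Z hF.1 Y hY, by simp [hmul Z hF.1 Y hY, hZ1, hφY],
          fun X hX hX1 ↦ ?_⟩
        rcases Finset.mem_insert.1 hX with rfl | hX
        · exact Set.inter_subset_left
        · exact Set.inter_subset_right.trans (hYF X hX hX1)
  obtain ⟨p, hpY, hp⟩ : ∃ p ∈ Y, ∀ X ∈ F, φ X = 0 → p ∉ X := by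
    by_contra! hcon
    let G := F.filter fun X ↦ φ X = 0
    have hYne : Y.Nonempty := by
      rw [Set.nonempty_iff_ne_empty]
      rintro rfl
      simp [h0] at hφY
    have hG : 0 < G.card := by
      obtain ⟨p, hp⟩ := hYne
      obtain ⟨X, hX, hX0, -⟩ := hcon p hp
      exact Finset.card_pos.2 ⟨X, Finset.mem_filter.2 ⟨hX, hX0⟩⟩
    have hGF (i : Fin G.card) := Finset.mem_filter.1 (G.equivFin.symm i).2
    obtain ⟨i, hi⟩ := hind Y hY G.card hG (fun i ↦ Y ∩ (G.equivFin.symm i).1)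
      (fun i ↦ hcap Y hY _ (hF (hGF i).1)) (by
        refine subset_antisymm (fun p hp ↦ ?_) (Set.iUnion_subset fun i ↦ Set.inter_subset_left)
        obtain ⟨X, hX, hX0, hpX⟩ := hcon p hp
        refine Set.mem_iUnion.2 ⟨G.equivFin ⟨X, Finset.mem_filter.2 ⟨hX, hX0⟩⟩, hp, ?_⟩
        simpa using hpX)
    have := hmul Y hY _ (hF (hGF i).1)
    rw [← hi, hφY, (hGF i).2] at this
    simp at this
  refine ⟨p, fun X hX ↦ ?_⟩
  rcases hval X (hF hX) with hX0 | hX1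
  · simp [indFn, hX0, hp X hX hX0]
  · simp [indFn, hX1, hYF X hX hX1 hpY]

/-- If `𝔍` is independent, every function `φ : 𝔍 → {0,1}` with `φ(∅) = 0` and
`φ(X₁ ∩ X₂) = φ(X₁)φ(X₂)` extends to a unique algebra homomorphism `χ : D → ℂ` with
`χ(1_X) = φ(X)`. -/
theorem stmt_3 {J : Set (Set 𝔓)} (h0 : (∅ : Set 𝔓) ∈ J)
    (hcap : ∀ X ∈ J, ∀ Y ∈ J, X ∩ Y ∈ J) (hind : IsIndepFamily J)
    (φ : Set 𝔓 → ℂ) (hval : ∀ X ∈ J, φ X = 0 ∨ φ X = 1) (h0' : φ ∅ = 0)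
    (hmul : ∀ X ∈ J, ∀ Y ∈ J, φ (X ∩ Y) = φ X * φ Y) :
    ∃! χ : Dalg J →ₙₐ[ℂ] ℂ, ∀ X : Set 𝔓, ∀ hX : X ∈ J, χ (indEl J X hX) = φ X := by
  suffices ∃ χ : BoundedContinuousFunction 𝔓 ℂ →ₙₐ[ℂ] ℂ, ∀ X ∈ J, χ (indFn X) = φ X by
    obtain ⟨χ, hχ⟩ := this
    refine ⟨χ.comp (NonUnitalStarSubalgebraClass.subtype (Dalg J)).toNonUnitalAlgHom,
      fun X hX ↦ hχ X hX, fun ψ hψ ↦ Dalg.nonUnitalAlgHom_ext fun X hX ↦ ?_⟩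
    exact (hψ X hX).trans (hχ X hX).symm
  by_cases hzero : ∀ X ∈ J, φ X = 0
  · exact ⟨0, fun X hX ↦ (hzero X hX).symm⟩
  push Not at hzero
  obtain ⟨X₀, hX₀, hne⟩ := hzero
  have hφ : φ X₀ = 1 := (hval X₀ hX₀).resolve_left hne
  obtain ⟨U, hU⟩ := Ultrafilter.exists_ultrafilter_of_finite_inter_nonempty
    ((fun X ↦ {p | indFn X p = φ X}) '' J) (by
      classical
      intro T hT
      obtain ⟨F, hF, rfl⟩ := Finset.subset_set_image_iff.1 hT
      obtain ⟨p, hp⟩ := hind.exists_indFn_eq hcap hval h0' hmul hX₀ hφ F hF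
      exact ⟨p, by simpa using hp⟩)
  obtain ⟨χ, hχ⟩ := BoundedContinuousFunction.exists_nonUnitalAlgHom_tendsto U
  refine ⟨χ, fun X hX ↦ tendsto_nhds_unique (hχ (indFn X)) ?_⟩
  exact tendsto_const_nhds.congr' (Filter.mem_of_superset (hU ⟨X, hX, rfl⟩) fun p hp ↦ hp.symm)
end

section
/- Assume P ⊆ G satisfies the Toeplitz condition. Then: (i) for every g ∈ G and X ∈ 𝒥, the set P ∩ (g·X) belongs to 𝒥; (ii) 𝒥_P^G = {g·X : g ∈ G, X ∈ 𝒥}, i.e. no intersections are needed. -/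
variable {G : Type*} [Group G]

/-- Left translate `g·X = {gx : x ∈ X}`. -/
def lmul (g : G) (X : Set G) : Set G := (g * ·) '' X

/-- `p⁻¹X = {y ∈ P : py ∈ X}`. -/
def presub (P : Submonoid G) (p : G) (X : Set G) : Set G := {y : G | y ∈ P ∧ p * y ∈ X}

/-- The constructible right ideals of `P`: the smallest family of subsets of `P`
containing `∅` and `P` and closed under `X ↦ pX` and `X ↦ p⁻¹X` for `p ∈ P`. -/
inductive IsConstructible (P : Submonoid G) : Set G → Prop
  | empty : IsConstructible P ∅
  | base : IsConstructible P (P : Set G)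
  | mul {p : G} (hp : p ∈ P) {X : Set G} (hX : IsConstructible P X) : IsConstructible P (lmul p X)
  | pre {p : G} (hp : p ∈ P) {X : Set G} (hX : IsConstructible P X) :
      IsConstructible P (presub P p X)

/-- `𝒥_P^G`: the smallest family of subsets of `G` containing `𝒥`, closed under left
translations by group elements and under finite intersections. -/
inductive IsConstructibleG (P : Submonoid G) : Set G → Prop
  | base {X : Set G} (hX : IsConstructible P X) : IsConstructibleG P X
  | translate (g : G) {Y : Set G} (hY : IsConstructibleG P Y) : IsConstructibleG P (lmul g Y)
  | inter {Y₁ Y₂ : Set G} (h1 : IsConstructibleG P Y₁) (h2 : IsConstructibleG P Y₂) :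
      IsConstructibleG P (Y₁ ∩ Y₂)

/-- The Toeplitz condition for `P ⊆ G` (set-theoretic form): for every `g ∈ G` with
`{x ∈ P : gx ∈ P} ≠ ∅` there are `p₁, q₁, …, pₙ, qₙ ∈ P` (`n ≥ 1`) with
`g = p₁⁻¹q₁⋯pₙ⁻¹qₙ` and `{x ∈ P : gx ∈ P} = qₙ⁻¹(pₙ(⋯(q₁⁻¹(p₁P))⋯))`. -/
def IsToeplitz (P : Submonoid G) : Prop :=
  ∀ g : G, {x : G | x ∈ P ∧ g * x ∈ P}.Nonempty →
    ∃ l : List (G × G), l ≠ [] ∧ (∀ pq ∈ l, pq.1 ∈ P ∧ pq.2 ∈ P) ∧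
      g = (l.map fun pq => pq.1⁻¹ * pq.2).prod ∧
      {x : G | x ∈ P ∧ g * x ∈ P} =
        l.foldl (fun S pq => presub P pq.2 (lmul pq.1 S)) (P : Set G)

/-- A `J`-valued filter. -/
def IsFilterOn {α : Type*} (J : Set (Set α)) (F : Set (Set α)) : Prop :=
  F ⊆ J ∧ (∀ X₁ ∈ F, ∀ X₂ ∈ J, X₁ ⊆ X₂ → X₂ ∈ F) ∧
    (∀ X₁ ∈ F, ∀ X₂ ∈ F, X₁ ∩ X₂ ∈ F) ∧ ∅ ∉ F

theorem mem_lmul_iff {g x : G} {X : Set G} : x ∈ lmul g X ↔ g⁻¹ * x ∈ X := by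
  constructor
  · rintro ⟨y, hy, rfl⟩
    simpa using hy
  · exact fun h => ⟨g⁻¹ * x, h, by simp⟩

theorem lmul_lmul (g h : G) (X : Set G) : lmul g (lmul h X) = lmul (g * h) X := by
  ext x
  simp [mem_lmul_iff, mul_assoc]

namespace IsConstructible

variable {P : Submonoid G}

theorem subset {X : Set G} (hX : IsConstructible P X) : X ⊆ P := by
  induction hX with
  | empty => exact Set.empty_subset _
  | base => exact subset_rfl
  | mul hp _ ih =>
    rintro _ ⟨y, hy, rfl⟩
    exact P.mul_mem hp (ih hy)
  | pre _ _ _ => exact fun _ hx => hx.1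

theorem inter {X : Set G} (hX : IsConstructible P X) {Y : Set G} (hY : IsConstructible P Y) :
    IsConstructible P (X ∩ Y) := by
  induction hX generalizing Y with
  | empty => simpa using IsConstructible.empty
  | base => rwa [Set.inter_eq_right.2 hY.subset]
  | @mul p hp X hX ih =>
    convert (ih (hY.pre hp)).mul hp using 1
    ext x
    simp only [Set.mem_inter_iff, mem_lmul_iff, presub, Set.mem_ofPred_eq, mul_inv_cancel_left]
    exact ⟨fun h => ⟨h.1, hX.subset h.1, h.2⟩, fun h => ⟨h.1, h.2.2⟩⟩
  | @pre p hp X hX ih =>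
    convert (ih (hY.mul hp)).pre hp using 1
    ext x
    simp only [Set.mem_inter_iff, mem_lmul_iff, presub, Set.mem_ofPred_eq, inv_mul_cancel_left]
    exact and_assoc

theorem foldl {l : List (G × G)} (hl : ∀ pq ∈ l, pq.1 ∈ P ∧ pq.2 ∈ P) {X : Set G}
    (hX : IsConstructible P X) :
    IsConstructible P (l.foldl (fun S pq => presub P pq.2 (lmul pq.1 S)) X) := by
  induction l generalizing X with
  | nil => exact hX
  | cons pq l ih =>
    have h := hl pq List.mem_cons_self
    exact ih (fun r hr => hl r (List.mem_cons_of_mem _ hr)) ((hX.mul h.1).pre h.2)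

end IsConstructible

theorem mem_foldl_presub_iff (P : Submonoid G) (l : List (G × G)) {S T : Set G} (hST : S ⊆ T)
    (x : G) :
    x ∈ l.foldl (fun S pq => presub P pq.2 (lmul pq.1 S)) S ↔
      x ∈ l.foldl (fun S pq => presub P pq.2 (lmul pq.1 S)) T ∧
        (l.map fun pq => pq.1⁻¹ * pq.2).prod * x ∈ S := by
  induction l generalizing S T with
  | nil => simpa using @hST x
  | cons pq l ih =>
    have hsub : presub P pq.2 (lmul pq.1 S) ⊆ presub P pq.2 (lmul pq.1 T) :=
      fun y hy => ⟨hy.1, Set.image_mono hST hy.2⟩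
    have hT := ih (subset_refl (presub P pq.2 (lmul pq.1 T)))
    simp only [List.foldl_cons, List.map_cons, List.prod_cons]
    rw [ih hsub]
    refine and_congr_right fun hx => ?_
    have hmem := (hT.1 hx).2.1
    simp only [presub, Set.mem_ofPred_eq, mem_lmul_iff, mul_assoc]
    exact and_iff_right hmem

theorem IsToeplitz.isConstructible_inter_lmul {P : Submonoid G} (hT : IsToeplitz P) (g : G)
    {X : Set G} (hX : IsConstructible P X) : IsConstructible P ((P : Set G) ∩ lmul g X) := by
  by_cases hne : {x : G | x ∈ P ∧ g⁻¹ * x ∈ P}.Nonempty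
  · obtain ⟨l, -, hl, hg, hdom⟩ := hT g⁻¹ hne
    convert hX.foldl hl using 1
    ext x
    rw [mem_foldl_presub_iff P l hX.subset, ← hdom, ← hg]
    simp only [Set.mem_inter_iff, mem_lmul_iff, Set.mem_ofPred_eq, SetLike.mem_coe]
    exact ⟨fun h => ⟨⟨h.1, hX.subset h.2⟩, h.2⟩, fun h => ⟨h.1.1, h.2⟩⟩
  · convert IsConstructible.empty (P := P)
    refine Set.eq_empty_of_forall_notMem fun x hx => hne ⟨x, hx.1, ?_⟩
    exact hX.subset (mem_lmul_iff.1 hx.2)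

/-- If `P ⊆ G` satisfies the Toeplitz condition, then (i) `P ∩ (g·X) ∈ 𝒥` for every
`g ∈ G` and `X ∈ 𝒥`, and (ii) `𝒥_P^G = {g·X : g ∈ G, X ∈ 𝒥}`. -/
theorem stmt_6 (P : Submonoid G) (hT : IsToeplitz P) :
    (∀ (g : G) (X : Set G), IsConstructible P X →
        IsConstructible P ((P : Set G) ∩ lmul g X)) ∧
      {Y : Set G | IsConstructibleG P Y} =
        {Y : Set G | ∃ (g : G) (X : Set G), IsConstructible P X ∧ Y = lmul g X} := by
  refine ⟨fun g X hX => hT.isConstructible_inter_lmul g hX, Set.ext fun Y => ⟨?_, ?_⟩⟩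
  · rintro (hY : IsConstructibleG P Y)
    induction hY with
    | @base X hX => exact ⟨1, X, hX, by simp [lmul]⟩
    | translate g _ ih =>
      obtain ⟨h, X, hX, rfl⟩ := ih
      exact ⟨g * h, X, hX, lmul_lmul g h X⟩
    | inter _ _ ih₁ ih₂ =>
      obtain ⟨g, X, hX, rfl⟩ := ih₁
      obtain ⟨h, Z, hZ, rfl⟩ := ih₂
      refine ⟨g, _, hX.inter (hT.isConstructible_inter_lmul (g⁻¹ * h) hZ), ?_⟩
      ext x
      simp only [Set.mem_inter_iff, mem_lmul_iff, mul_inv_rev, inv_inv, mul_assoc,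
        mul_inv_cancel_left]
      exact and_congr_right fun hx => (and_iff_right (hX.subset hx)).symm
  · rintro ⟨g, X, hX, rfl⟩
    exact (IsConstructibleG.base hX).translate g
end
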